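/- Let A ∈ ℝ^{d×d} be Hurwitz, i.e., every complex root of its characteristic polynomial has strictly negative real part. Then there exist a real symmetric positive definite d×d matrix P and a real number λ > 0 such that for all ξ ∈ ℝ^d and all t ≥ 0, ⟨P exp(A t) ξ, exp(A t) ξ⟩ ≤ exp(−λ t) · ⟨P ξ, ξ⟩. -/

import Mathlib

open Matrix Polynomial

attribute [local instance] Matrix.linftyOpNormedRing Matrix.linftyOpNormedAlgebra

open Filter Topology
open scoped NNReal ENNReal

/-- Finitely many points of the open left half plane are mapped into the open unit disc by
`z ↦ 1 + h z` for all small `h > 0`. -/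
lemma exists_pos_forall_norm_one_add_mul_lt_one {S : Set ℂ} (hS : S.Finite)
    (hre : ∀ z ∈ S, z.re < 0) : ∃ h : ℝ, 0 < h ∧ ∀ z ∈ S, ‖1 + (h : ℂ) * z‖ < 1 := by
  have key : ∀ᶠ h : ℝ in 𝓝[>] 0, ∀ z ∈ S, ‖1 + (h : ℂ) * z‖ < 1 := by
    rw [eventually_all_finite hS]
    intro z hz
    have hlim : Tendsto (fun h : ℝ => 2 * z.re + h * Complex.normSq z) (𝓝[>] 0)
        (𝓝 (2 * z.re + 0 * Complex.normSq z)) :=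
      (Continuous.tendsto (by fun_prop) 0).mono_left nhdsWithin_le_nhds
    have hneg : 2 * z.re + 0 * Complex.normSq z < 0 := by linarith [hre z hz]
    filter_upwards [hlim.eventually_lt_const hneg, self_mem_nhdsWithin] with h hh hpos
    have hpos : 0 < h := hpos
    have hsq : ‖1 + (h : ℂ) * z‖ ^ 2 = 1 + h * (2 * z.re + h * Complex.normSq z) := by
      rw [Complex.sq_norm, Complex.normSq_apply, Complex.normSq_apply]
      simp
      ring
    have := mul_neg_of_pos_of_neg hpos hh
    exact lt_of_pow_lt_pow_left₀ 2 zero_le_one (by rw [hsq]; linarith)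
  obtain ⟨h, hh, hpos⟩ := (key.and self_mem_nhdsWithin).exists
  exact ⟨h, hpos, hh⟩

/-- If the spectrum of an element of a complex Banach algebra is contained in the open unit disc,
then its powers decay geometrically. -/
lemma exists_eventually_norm_pow_le_of_spectrum {R : Type*} [NormedRing R] [NormedAlgebra ℂ R]
    [CompleteSpace R] (a : R) (ha : ∀ z ∈ spectrum ℂ a, ‖z‖ < 1) :
    ∃ r : ℝ, 0 ≤ r ∧ r < 1 ∧ ∀ᶠ n : ℕ in atTop, ‖a ^ n‖ ≤ r ^ n := by
  have hrad : spectralRadius ℂ a < 1 := by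
    rcases (spectrum ℂ a).eq_empty_or_nonempty with h | h
    · simp [spectralRadius, h]
    · exact_mod_cast spectrum.spectralRadius_lt_of_forall_lt_of_nonempty h (r := 1)
        fun z hz => by exact_mod_cast ha z hz
  obtain ⟨r, hr, hr1⟩ := ENNReal.lt_iff_exists_nnreal_btwn.mp hrad
  refine ⟨r, r.2, by exact_mod_cast hr1, ?_⟩
  have hev := (spectrum.pow_nnnorm_pow_one_div_tendsto_nhds_spectralRadius a).eventually_lt_const hr
  filter_upwards [hev, eventually_gt_atTop 0] with n hn hn0
  have hn0' : (0 : ℝ) < n := by exact_mod_cast hn0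
  rw [one_div, ENNReal.rpow_inv_lt_iff hn0', ENNReal.rpow_natCast] at hn
  have : ‖a ^ n‖₊ < r ^ n := by exact_mod_cast hn
  exact_mod_cast this.le

lemma Matrix.norm_entry_le_linfty_opNorm {d : ℕ} (M : Matrix (Fin d) (Fin d) ℂ) (i j : Fin d) :
    ‖M i j‖ ≤ ‖M‖ := by
  have h1 : ‖M i j‖₊ ≤ ∑ k, ‖M i k‖₊ :=
    Finset.single_le_sum (f := fun k => ‖M i k‖₊) (fun _ _ => zero_le) (Finset.mem_univ j)
  have h2 : ∑ k, ‖M i k‖₊ ≤ ‖M‖₊ := by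
    rw [Matrix.linfty_opNNNorm_def]
    exact Finset.le_sup (f := fun i => ∑ k, ‖M i k‖₊) (Finset.mem_univ i)
  exact_mod_cast h1.trans h2

/-- The series defining the solution of the discrete Lyapunov equation converges for Schur stable
matrices. -/
lemma Matrix.summable_transpose_pow_mul_pow {d : ℕ} (B : Matrix (Fin d) (Fin d) ℝ)
    (hB : ∀ z ∈ spectrum ℂ (B.map (algebraMap ℝ ℂ)), ‖z‖ < 1) :
    Summable fun n : ℕ => (B ^ n)ᵀ * B ^ n := by
  obtain ⟨r, hr0, hr1, hr⟩ := exists_eventually_norm_pow_le_of_spectrum _ hB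
  have hentry : ∀ᶠ n : ℕ in atTop, ∀ i j, |(B ^ n) i j| ≤ r ^ n := by
    filter_upwards [hr] with n hn i j
    have h := (Matrix.norm_entry_le_linfty_opNorm _ i j).trans hn
    rw [← Matrix.map_pow] at h
    simpa using h
  have hgeom : Summable fun n : ℕ => (d : ℝ) * (r ^ 2) ^ n :=
    (summable_geometric_of_lt_one (sq_nonneg r) (by nlinarith)).mul_left _
  refine Pi.summable.2 fun i => Pi.summable.2 fun j => ?_
  refine hgeom.of_norm_bounded_eventually_nat ?_
  filter_upwards [hentry] with n hn
  rw [Matrix.mul_apply]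
  refine (norm_sum_le _ _).trans ?_
  calc ∑ k, ‖(B ^ n)ᵀ i k * (B ^ n) k j‖ ≤ ∑ _k : Fin d, (r ^ 2) ^ n := by
        refine Finset.sum_le_sum fun k _ => ?_
        rw [norm_mul, Matrix.transpose_apply, ← pow_mul, two_mul, pow_add]
        exact mul_le_mul (hn k i) (hn k j) (abs_nonneg _) (pow_nonneg hr0 n)
    _ = d * (r ^ 2) ^ n := by simp

/-- Solvability of the discrete Lyapunov equation `P = 1 + Bᵀ P B` for Schur stable `B`. -/
lemma Matrix.exists_posDef_eq_one_add_transpose_mul_mul {d : ℕ} (B : Matrix (Fin d) (Fin d) ℝ)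
    (hB : ∀ z ∈ spectrum ℂ (B.map (algebraMap ℝ ℂ)), ‖z‖ < 1) :
    ∃ P : Matrix (Fin d) (Fin d) ℝ, P.PosDef ∧ P = 1 + Bᵀ * P * B := by
  have hs := Matrix.summable_transpose_pow_mul_pow B hB
  set P := ∑' n : ℕ, (B ^ n)ᵀ * B ^ n with hP
  have hsymm : Pᵀ = P := by
    rw [hP, Matrix.transpose_tsum]
    simp
  have heq : P = 1 + Bᵀ * P * B := by
    rw [hP, ← hs.tsum_mul_left, ← (hs.mul_left _).tsum_mul_right, hs.tsum_eq_zero_add]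
    simp [pow_succ, Matrix.mul_assoc]
  have hpsd : ∀ x : Fin d → ℝ, 0 ≤ x ⬝ᵥ P *ᵥ x := by
    intro x
    let q : Matrix (Fin d) (Fin d) ℝ →+ ℝ :=
      { toFun := fun M => x ⬝ᵥ M *ᵥ x
        map_zero' := by simp
        map_add' := fun M N => by simp [Matrix.add_mulVec] }
    have hq : Continuous q :=
      continuous_const.dotProduct (continuous_id.matrix_mulVec continuous_const)
    refine (hs.hasSum.map q hq).nonneg fun n => ?_
    change 0 ≤ x ⬝ᵥ ((B ^ n)ᵀ * B ^ n) *ᵥ x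
    rw [← Matrix.mulVec_mulVec, Matrix.dotProduct_mulVec, Matrix.vecMul_transpose]
    exact Finset.sum_nonneg fun _ _ => mul_self_nonneg _
  refine ⟨P, .of_dotProduct_mulVec_pos hsymm fun x hx => ?_, heq⟩
  have h1 : x ⬝ᵥ P *ᵥ x = x ⬝ᵥ x + (B *ᵥ x) ⬝ᵥ P *ᵥ (B *ᵥ x) := by
    conv_lhs => rw [heq]
    rw [Matrix.add_mulVec, Matrix.one_mulVec, dotProduct_add, ← Matrix.mulVec_mulVec,
      ← Matrix.mulVec_mulVec, Matrix.dotProduct_mulVec x, Matrix.vecMul_transpose]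
  have h2 : 0 < x ⬝ᵥ x := by simpa using Matrix.dotProduct_star_self_pos_iff.2 hx
  rw [star_trivial, h1]
  linarith [hpsd (B *ᵥ x)]

/-- The quadratic form of a real matrix is bounded by a multiple of the squared norm. -/
lemma Matrix.exists_pos_mulVec_dotProduct_le {d : ℕ} (P : Matrix (Fin d) (Fin d) ℝ) :
    ∃ K : ℝ, 0 < K ∧ ∀ x : Fin d → ℝ, P *ᵥ x ⬝ᵥ x ≤ K * (x ⬝ᵥ x) := by
  refine ⟨1 + ∑ i, ∑ j, |P i j|, by positivity, fun x => ?_⟩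
  have hle : ∀ i, x i ^ 2 ≤ x ⬝ᵥ x := fun i => by
    rw [sq]
    exact Finset.single_le_sum (f := fun i => x i * x i) (fun _ _ => mul_self_nonneg _)
      (Finset.mem_univ i)
  have hxx : 0 ≤ x ⬝ᵥ x := Finset.sum_nonneg fun _ _ => mul_self_nonneg _
  have hsum : P *ᵥ x ⬝ᵥ x ≤ (∑ i, ∑ j, |P i j|) * (x ⬝ᵥ x) := by
    simp only [dotProduct, mulVec, Finset.sum_mul] at hle ⊢
    refine Finset.sum_le_sum fun i _ => Finset.sum_le_sum fun j _ => ?_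
    have h1 : |x j * x i| ≤ x ⬝ᵥ x := by
      have hi := hle i
      have hj := hle j
      rw [abs_le]
      simp only [dotProduct]
      constructor <;> nlinarith [sq_nonneg (x i + x j), sq_nonneg (x i - x j)]
    calc P i j * x j * x i ≤ |P i j * (x j * x i)| := by rw [mul_assoc]; exact le_abs_self _
      _ ≤ |P i j| * (x ⬝ᵥ x) := by
        rw [abs_mul]; exact mul_le_mul_of_nonneg_left h1 (abs_nonneg _)
  linarith

/-- The Lyapunov inequality for Hurwitz matrices. -/
lemma Matrix.exists_posDef_lyapunov {d : ℕ} (A : Matrix (Fin d) (Fin d) ℝ)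
    (hA : ∀ z : ℂ, (A.charpoly.map (algebraMap ℝ ℂ)).IsRoot z → z.re < 0) :
    ∃ (P : Matrix (Fin d) (Fin d) ℝ) (c : ℝ), P.PosDef ∧ 0 < c ∧
      ∀ x : Fin d → ℝ, P *ᵥ (A *ᵥ x) ⬝ᵥ x + P *ᵥ x ⬝ᵥ A *ᵥ x ≤ -c * (P *ᵥ x ⬝ᵥ x) := by
  set A' : Matrix (Fin d) (Fin d) ℂ := A.map (algebraMap ℝ ℂ) with hA'
  have hspec : ∀ z ∈ spectrum ℂ A', z.re < 0 := fun z hz => hA z <| by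
    rwa [Matrix.mem_spectrum_iff_isRoot_charpoly, hA', Matrix.charpoly_map] at hz
  obtain ⟨h, hpos, hh⟩ := exists_pos_forall_norm_one_add_mul_lt_one A'.finite_spectrum hspec
  have hBspec : ∀ z ∈ spectrum ℂ ((1 + h • A).map (algebraMap ℝ ℂ)), ‖z‖ < 1 := by
    have hmap : (1 + h • A).map (algebraMap ℝ ℂ) =
        algebraMap ℂ (Matrix (Fin d) (Fin d) ℂ) 1 + (h : ℂ) • A' := by
      ext i j
      by_cases hij : i = j <;> simp [hA', hij]
    have hne : (h : ℂ) ≠ 0 := by exact_mod_cast hpos.ne'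
    rw [hmap, ← spectrum.singleton_add_eq, ← Units.val_mk0 hne, ← Units.smul_def,
      spectrum.unit_smul_eq_smul]
    rintro z hz
    rw [Set.singleton_add] at hz
    obtain ⟨w, hw, rfl⟩ := hz
    obtain ⟨v, hv, rfl⟩ := hw
    exact hh v hv
  obtain ⟨P, hPpos, hP⟩ := Matrix.exists_posDef_eq_one_add_transpose_mul_mul _ hBspec
  obtain ⟨K, hK, hPK⟩ := Matrix.exists_pos_mulVec_dotProduct_le P
  refine ⟨P, (h * K)⁻¹, hPpos, by positivity, fun x => ?_⟩
  have hquad : P *ᵥ x ⬝ᵥ x = x ⬝ᵥ x +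
      P *ᵥ ((1 + h • A) *ᵥ x) ⬝ᵥ ((1 + h • A) *ᵥ x) := by
    conv_lhs => rw [hP]
    rw [Matrix.add_mulVec, Matrix.one_mulVec, add_dotProduct, ← Matrix.mulVec_mulVec,
      ← Matrix.mulVec_mulVec, dotProduct_comm (_ᵀ *ᵥ _) x, Matrix.dotProduct_mulVec x,
      Matrix.vecMul_transpose, dotProduct_comm (P *ᵥ _)]
  simp only [Matrix.add_mulVec, Matrix.one_mulVec, Matrix.smul_mulVec, Matrix.mulVec_add,
    Matrix.mulVec_smul, add_dotProduct, dotProduct_add, smul_dotProduct, dotProduct_smul,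
    smul_eq_mul] at hquad
  have hAx : 0 ≤ P *ᵥ (A *ᵥ x) ⬝ᵥ A *ᵥ x := by
    simpa [dotProduct_comm] using hPpos.posSemidef.dotProduct_mulVec_nonneg (A *ᵥ x)
  have hxK := hPK x
  have hstep : h * (P *ᵥ (A *ᵥ x) ⬝ᵥ x + P *ᵥ x ⬝ᵥ A *ᵥ x) ≤ -(x ⬝ᵥ x) := by
    nlinarith [mul_nonneg (mul_nonneg hpos.le hpos.le) hAx]
  have hfin : (h * K) * (P *ᵥ (A *ᵥ x) ⬝ᵥ x + P *ᵥ x ⬝ᵥ A *ᵥ x) ≤ -(P *ᵥ x ⬝ᵥ x) := by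
    nlinarith [mul_le_mul_of_nonneg_left hstep hK.le]
  have hhK : 0 < h * K := by positivity
  rw [neg_mul, ← mul_neg, inv_mul_eq_div, le_div_iff₀ hhK]
  linarith

lemma HasDerivAt.dotProduct {d : ℕ} {u v : ℝ → Fin d → ℝ} {u' v' : Fin d → ℝ} {t : ℝ}
    (hu : HasDerivAt u u' t) (hv : HasDerivAt v v' t) :
    HasDerivAt (fun s => u s ⬝ᵥ v s) (u' ⬝ᵥ v t + u t ⬝ᵥ v') t := by
  have h := HasDerivAt.fun_sum (u := Finset.univ) fun i _ =>
    (hasDerivAt_pi.1 hu i).mul (hasDerivAt_pi.1 hv i)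
  simpa only [_root_.dotProduct, Pi.mul_apply, ← Finset.sum_add_distrib] using h

lemma HasDerivAt.const_mulVec {d : ℕ} (M : Matrix (Fin d) (Fin d) ℝ) {u : ℝ → Fin d → ℝ}
    {u' : Fin d → ℝ} {t : ℝ} (hu : HasDerivAt u u' t) :
    HasDerivAt (fun s => M *ᵥ u s) (M *ᵥ u') t :=
  (LinearMap.toContinuousLinearMap M.mulVecLin).hasFDerivAt.comp_hasDerivAt t hu

lemma Matrix.hasDerivAt_exp_smul_mulVec {d : ℕ} (A : Matrix (Fin d) (Fin d) ℝ) (ξ : Fin d → ℝ)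
    (t : ℝ) :
    HasDerivAt (fun s : ℝ => NormedSpace.exp (s • A) *ᵥ ξ)
      (A *ᵥ (NormedSpace.exp (t • A) *ᵥ ξ)) t := by
  have h := (LinearMap.toContinuousLinearMap
    ((Matrix.mulVecBilin ℝ ℝ).flip ξ : Matrix (Fin d) (Fin d) ℝ →ₗ[ℝ] (Fin d → ℝ))).hasFDerivAt
    |>.comp_hasDerivAt t (hasDerivAt_exp_smul_const' A t)
  rw [Matrix.mulVec_mulVec]
  exact h

/-- **Fact.**  If `A ∈ ℝ^{d×d}` is Hurwitz (all complex roots of its characteristic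
polynomial have negative real part), then there exist a symmetric positive definite `P`
and `λ > 0` such that `⟨P exp(At) ξ, exp(At) ξ⟩ ≤ exp(−λ t) ⟨P ξ, ξ⟩` for all `ξ` and
all `t ≥ 0`. -/
theorem hurwitz_flow_upper_bound
    {d : ℕ} (A : Matrix (Fin d) (Fin d) ℝ)
    (hA : ∀ z : ℂ, (A.charpoly.map (algebraMap ℝ ℂ)).IsRoot z → z.re < 0) :
    ∃ (P : Matrix (Fin d) (Fin d) ℝ) (lam : ℝ), P.PosDef ∧ 0 < lam ∧
      ∀ ξ : Fin d → ℝ, ∀ t : ℝ, 0 ≤ t →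
        P.mulVec ((NormedSpace.exp (t • A)).mulVec ξ) ⬝ᵥ
          (NormedSpace.exp (t • A)).mulVec ξ ≤
        Real.exp (-lam * t) * (P.mulVec ξ ⬝ᵥ ξ) := by
  obtain ⟨P, c, hP, hc, hlyap⟩ := Matrix.exists_posDef_lyapunov A hA
  refine ⟨P, c, hP, hc, fun ξ t ht => ?_⟩
  have hder : ∀ s : ℝ, HasDerivAt
      (fun s : ℝ => Real.exp (c * s) *
        (P *ᵥ (NormedSpace.exp (s • A) *ᵥ ξ) ⬝ᵥ NormedSpace.exp (s • A) *ᵥ ξ)) _ s := fun s =>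
    ((hasDerivAt_id s).const_mul c).exp.mul
      (((Matrix.hasDerivAt_exp_smul_mulVec A ξ s).const_mulVec P).dotProduct
        (Matrix.hasDerivAt_exp_smul_mulVec A ξ s))
  have hanti := antitone_of_deriv_nonpos (fun s => (hder s).differentiableAt) fun s => by
    rw [(hder s).deriv]
    have h1 := hlyap (NormedSpace.exp (s • A) *ᵥ ξ)
    have h2 := mul_le_mul_of_nonneg_left h1 (Real.exp_pos (c * s)).le
    simp only [id, mul_one]
    linarith
  have h := hanti ht
  simp only [mul_zero, Real.exp_zero, zero_smul, NormedSpace.exp_zero, Matrix.one_mulVec,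
    one_mul] at h
  rw [neg_mul, Real.exp_neg, inv_mul_eq_div, le_div_iff₀ (Real.exp_pos _)]
  linarith
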